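/- For all C > 0 and β > 0 there exists C' > 0 such that for all real numbers ν > 0, h > 0, A > 0, B > 0 and X ≥ 0, P ≥ 0 satisfying β P ≤ C (ν X + h (ν A + B)) and ν X² ≤ C (h A · P + ν h A · X + h B · X), one has X ≤ C' h (A + B/ν) and P ≤ C' h (ν A + B). -/

import Mathlib

/-- A quadratic inequality `X² ≤ K S X + K S²` forces `X ≤ (K + 1) S`. -/
theorem le_of_sq_le_mul_add_sq {K S X : ℝ} (hK : 0 ≤ K) (hS : 0 < S)
    (h : X ^ 2 ≤ K * S * X + K * S ^ 2) : X ≤ (K + 1) * S := by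
  by_contra! hlt
  have hSX : S < X := by nlinarith [mul_nonneg hK hS.le]
  nlinarith [mul_pos (sub_pos.2 hlt) (hS.trans hSX), mul_pos hS (sub_pos.2 hlt), sq_pos_of_pos hS]

/-- Quantitative skeleton of the error estimates for the mEG method
(Theorem 4.2): from the pressure residual bound and the tested error equation
one deduces the optimal first-order estimates for both velocity and pressure. -/
theorem meg_error_estimates_skeleton :
    ∀ C β : ℝ, 0 < C → 0 < β → ∃ C' : ℝ, 0 < C' ∧
      ∀ ν h A B X P : ℝ, 0 < ν → 0 < h → 0 < A → 0 < B → 0 ≤ X → 0 ≤ P →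
        β * P ≤ C * (ν * X + h * (ν * A + B)) →
        ν * X ^ 2 ≤ C * (h * A * P + ν * h * A * X + h * B * X) →
        X ≤ C' * h * (A + B / ν) ∧ P ≤ C' * h * (ν * A + B) := by
  intro C β hC hβ
  obtain ⟨D, hD⟩ : ∃ D, D = C / β := ⟨_, rfl⟩
  have hD0 : 0 < D := hD ▸ div_pos hC hβ
  obtain ⟨K, hK⟩ : ∃ K, K = C * (D + 1) := ⟨_, rfl⟩
  have hK0 : 0 < K := hK ▸ by positivity
  refine ⟨(K + 1) + D * (K + 2), by positivity, ?_⟩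
  intro ν h A B X P hν hh hA hB hX _ hres htest
  obtain ⟨S, hS⟩ : ∃ S, S = h * (A + B / ν) := ⟨_, rfl⟩
  have hS0 : 0 < S := hS ▸ by positivity
  have hνS : ν * S = h * (ν * A + B) := by rw [hS]; field_simp
  have hAS : h * A ≤ S := by
    rw [hS]
    have : 0 < B / ν := by positivity
    gcongr
    linarith
  have hP : P ≤ D * (ν * (X + S)) := by
    rw [hD, div_mul_eq_mul_div, le_div_iff₀ hβ, mul_add ν, hνS]
    linarith
  have hAP : h * A * P ≤ S * (D * (ν * (X + S))) := by
    calc h * A * P ≤ h * A * (D * (ν * (X + S))) := by gcongr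
      _ ≤ S * (D * (ν * (X + S))) := by gcongr
  have hquad : X ^ 2 ≤ K * S * X + K * S ^ 2 := by
    refine le_of_mul_le_mul_left ?_ hν
    calc ν * X ^ 2 ≤ C * (h * A * P + ν * h * A * X + h * B * X) := htest
      _ = C * (h * A * P + ν * S * X) := by rw [hνS]; ring
      _ ≤ C * (S * (D * (ν * (X + S))) + ν * S * X) := by gcongr
      _ ≤ C * (S * (D * (ν * (X + S))) + ν * S * X) + C * ν * S ^ 2 :=
        le_add_of_nonneg_right (by positivity)
      _ = ν * (K * S * X + K * S ^ 2) := by rw [hK]; ring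
  have hXS := le_of_sq_le_mul_add_sq hK0.le hS0 hquad
  constructor
  · rw [mul_assoc, ← hS]
    have : 0 ≤ D * (K + 2) * S := by positivity
    linarith
  · rw [mul_assoc, ← hνS]
    calc P ≤ D * (ν * (X + S)) := hP
      _ ≤ D * (ν * ((K + 1) * S + S)) := by gcongr
      _ ≤ D * (ν * ((K + 1) * S + S)) + (K + 1) * (ν * S) :=
        le_add_of_nonneg_right (by positivity)
      _ = ((K + 1) + D * (K + 2)) * (ν * S) := by ring
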